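/- For each j ∈ {0,1} there exists a unique function χ_j ∈ C^∞((0,∞)) solving the ODE Z χ_j⁽⁵⁾ − j χ_j⁽⁴⁾ + 4 χ_j = 0 on (0,∞), endowed with the boundary conditions χ₀(0) = χ₀′(0) = 0, χ₀⁽⁴⁾(0) = 1 (for j = 0) and χ₁′(0) = χ₁⁽⁴⁾(0) = 0, χ₁⁽⁵⁾(0) = 1 (for j = 1), and such that ∫₀^∞ |χ_j⁽ᵏ⁾(Z)| e^{cZ^{4/5}} dZ < ∞ for 0 ≤ k ≤ 4 and some c > 0. Furthermore, these solutions satisfy χ₀⁽⁵⁾(0) = 0 and χ₁(0) = 0. -/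

import Mathlib

noncomputable section
open MeasureTheory Real Set Filter

/-- Boundary conditions for `χ_j` at `Z = 0`: for `j = 0`, `χ₀(0) = χ₀′(0) = 0` and
`χ₀⁽⁴⁾(0) = 1`; for `j = 1`, `χ₁′(0) = χ₁⁽⁴⁾(0) = 0` and `χ₁⁽⁵⁾(0) = 1`. -/
def ChiBC (j : ℕ) (χ : ℝ → ℝ) : Prop :=
  (j = 0 → χ 0 = 0 ∧ deriv χ 0 = 0 ∧ iteratedDeriv 4 χ 0 = 1) ∧
  (j = 1 → deriv χ 0 = 0 ∧ iteratedDeriv 4 χ 0 = 0 ∧ iteratedDeriv 5 χ 0 = 1)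

/-! ### Elementary bounds -/

lemma lin_sub_exp_le (N X c : ℝ) (hc : 0 < c) :
    ∃ C : ℝ, ∀ x ≤ X, N * x - c * exp (-4 * x) ≤ C := by
  refine ⟨N ^ 2 / (32 * c) + |N| * |X|, fun x hx => ?_⟩
  rcases le_total x 0 with h | h
  · have h1 : (-4 * x) ^ 2 / 2 ≤ exp (-4 * x) := by
      have := Real.quadratic_le_exp_of_nonneg (x := -4 * x) (by linarith)
      nlinarith
    have h2 : N * x - c * (8 * x ^ 2) ≤ N ^ 2 / (32 * c) := by
      rw [le_div_iff₀ (by positivity)]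
      nlinarith [sq_nonneg (N - 16 * c * x)]
    have h3 : 0 ≤ |N| * |X| := by positivity
    nlinarith
  · have h1 : N * x ≤ |N| * |X| := by
      calc N * x ≤ |N * x| := le_abs_self _
        _ = |N| * |x| := abs_mul _ _
        _ ≤ |N| * |X| := by
          exact mul_le_mul_of_nonneg_left (abs_le_abs_of_nonneg h hx) (abs_nonneg _)
    have h2 : 0 ≤ N ^ 2 / (32 * c) := by positivity
    have h3 : 0 < c * exp (-4 * x) := by positivity
    linarith

lemma integrableOn_lin_sub_exp (N X c : ℝ) (hc : 0 < c) :
    IntegrableOn (fun x => exp (N * x - c * exp (-4 * x))) (Iic X) := by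
  obtain ⟨C, hC⟩ := lin_sub_exp_le (N - 1) X c hc
  refine Integrable.mono' ((integrableOn_exp_Iic X).const_mul (exp C))
    (Continuous.aestronglyMeasurable (by fun_prop)) ?_
  refine (ae_restrict_iff' measurableSet_Iic).2 (Eventually.of_forall fun x hx => ?_)
  rw [Real.norm_eq_abs, abs_of_pos (exp_pos _), ← Real.exp_add]
  apply exp_le_exp.2
  have := hC x hx
  linarith

lemma integrable_neg_sub_exp (k c : ℝ) (hk : 0 < k) (hc : 0 < c) :
    Integrable (fun x => exp (-k * x - c * exp (-4 * x))) := by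
  rw [← integrableOn_univ, ← Iic_union_Ioi (a := (0:ℝ))]
  refine (integrableOn_lin_sub_exp (-k) 0 c hc).union ?_
  refine Integrable.mono' (integrableOn_exp_mul_Ioi (a := -k) (by linarith) 0)
    (Continuous.aestronglyMeasurable (by fun_prop)) ?_
  refine (ae_restrict_iff' measurableSet_Ioi).2 (Eventually.of_forall fun x hx => ?_)
  rw [Real.norm_eq_abs, abs_of_pos (exp_pos _)]
  apply exp_le_exp.2
  have : 0 < c * exp (-4 * x) := by positivity
  linarith

/-! ### Uniqueness -/

/-- vanishing of all initial data implies vanishing -/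
lemma zero_of_data (f : ℕ → ℝ → ℝ) (hf : ∀ k x, HasDerivAt (f k) (f (k+1) x) x)
    (hode : ∀ Z > (0:ℝ), Z * f 5 Z + 4 * f 0 Z = 0)
    (h0 : ∀ k ≤ 4, f k 0 = 0) : ∀ Z ≥ (0:ℝ), f 0 Z = 0 := by
  intro T hT
  have hcont : ∀ k, Continuous (f k) := fun k =>
    continuous_iff_continuousAt.2 fun x => (hf k x).continuousAt
  let S : ℝ → ℝ := fun t => |f 0 t| + |f 1 t| + |f 2 t| + |f 3 t| + |f 4 t|
  have hScont : Continuous (fun t => S t * exp (-(10 * t))) := by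
    have h0 := hcont 0; have h1 := hcont 1; have h2 := hcont 2
    have h3 := hcont 3; have h4 := hcont 4
    fun_prop
  obtain ⟨t0, ht0, hmax⟩ := isCompact_Icc.exists_isMaxOn (nonempty_Icc.2 hT) hScont.continuousOn
  set N := S t0 * exp (-(10 * t0)) with hN
  have hSle : ∀ t ∈ Icc 0 T, S t ≤ N * exp (10 * t) := by
    intro t ht
    have h1 : S t * exp (-(10 * t)) ≤ N := hmax ht
    have h2 := mul_le_mul_of_nonneg_right h1 (exp_pos (10 * t)).le
    rwa [mul_assoc, ← Real.exp_add, neg_add_cancel, Real.exp_zero, mul_one] at h2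
  have hS0 : ∀ t, 0 ≤ S t := fun t => by positivity
  have hN0 : 0 ≤ N := mul_nonneg (hS0 _) (exp_pos _).le
  have hB : ∀ (c : ℝ) (x : ℝ), HasDerivAt (fun t => c * N / 10 * exp (10 * t)) (c * N * exp (10 * x)) x := by
    intro c x
    have := ((hasDerivAt_id x).const_mul 10).exp.const_mul (c * N / 10)
    refine this.congr_deriv ?_
    simp only [id]; ring
  have key : ∀ (k : ℕ) (c : ℝ), 0 ≤ c → k ≤ 4 → (∀ t ∈ Icc 0 T, |f (k+1) t| ≤ c * N * exp (10 * t)) →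
      ∀ t ∈ Icc 0 T, |f k t| ≤ c * N / 10 * exp (10 * t) := by
    intro k c hc hk hb t ht
    refine image_norm_le_of_norm_deriv_right_le_deriv_boundary (f := f k) (f' := f (k+1))
      (hcont k).continuousOn (fun x _ => (hf k x).hasDerivWithinAt) ?_ (hB c)
      (fun x hx => hb x ⟨hx.1, hx.2.le⟩) ht
    rw [h0 k hk]; simp; positivity
  have hk : ∀ k ≤ 4, ∀ t ∈ Icc 0 T, |f k t| ≤ 1 * N * exp (10 * t) := by
    intro k hk t ht
    have h := hSle t ht
    simp only [S] at h
    have := abs_nonneg (f 0 t); have := abs_nonneg (f 1 t); have := abs_nonneg (f 2 t)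
    have := abs_nonneg (f 3 t); have := abs_nonneg (f 4 t)
    interval_cases k <;> linarith
  have h5 : ∀ t ∈ Ioc 0 T, |f 5 t| ≤ 4 * N * exp (10 * t) := by
    intro t ht
    have h1 : ‖f 0 t - f 0 0‖ ≤ N * exp (10 * t) * ‖t - 0‖ := by
      refine Convex.norm_image_sub_le_of_norm_hasDerivWithin_le (f' := f 1) (s := Icc 0 t)
        (fun x _ => (hf 0 x).hasDerivWithinAt) ?_ (convex_Icc _ _) ⟨le_rfl, ht.1.le⟩ ⟨ht.1.le, le_rfl⟩
      intro x hx
      refine (hk 1 (by norm_num) x ⟨hx.1, hx.2.trans ht.2⟩).trans ?_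
      rw [one_mul]
      gcongr
      exact hx.2
    rw [h0 0 (by norm_num), sub_zero, sub_zero, Real.norm_eq_abs, Real.norm_eq_abs,
      abs_of_pos ht.1] at h1
    have h2 : t * |f 5 t| = 4 * |f 0 t| := by
      have : t * f 5 t = -(4 * f 0 t) := by linarith [hode t ht.1]
      calc t * |f 5 t| = |t * f 5 t| := by rw [abs_mul, abs_of_pos ht.1]
        _ = 4 * |f 0 t| := by rw [this, abs_neg, abs_mul]; norm_num
    have h3 : t * |f 5 t| ≤ t * (4 * N * exp (10 * t)) := by
      rw [h2]; nlinarith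
    exact le_of_mul_le_mul_left h3 ht.1
  rcases hT.eq_or_lt with rfl | hT'
  · exact h0 0 (by norm_num)
  have h5' : ∀ t ∈ Icc 0 T, |f 5 t| ≤ 4 * N * exp (10 * t) := by
    intro t ht
    have hcl : IsClosed {t | |f 5 t| ≤ 4 * N * exp (10 * t)} :=
      isClosed_le ((hcont 5).abs) (by fun_prop)
    have : closure (Ioc 0 T) ⊆ {t | |f 5 t| ≤ 4 * N * exp (10 * t)} :=
      hcl.closure_subset_iff.2 h5
    rw [closure_Ioc hT'.ne] at this
    exact this ht
  have b4 := key 4 4 (by norm_num) le_rfl h5' t0 ht0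
  have b3 := key 3 1 (by norm_num) (by norm_num) (hk 4 (by norm_num)) t0 ht0
  have b2 := key 2 1 (by norm_num) (by norm_num) (hk 3 (by norm_num)) t0 ht0
  have b1 := key 1 1 (by norm_num) (by norm_num) (hk 2 (by norm_num)) t0 ht0
  have b0 := key 0 1 (by norm_num) (by norm_num) (hk 1 (by norm_num)) t0 ht0
  have hS : S t0 ≤ 8 / 10 * N * exp (10 * t0) := by
    simp only [S]; linarith
  have hN1 : N ≤ 8 / 10 * N := by
    have h2 := mul_le_mul_of_nonneg_right hS (exp_pos (-(10 * t0))).le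
    rw [mul_assoc _ (exp _), ← Real.exp_add, add_neg_cancel, Real.exp_zero, mul_one] at h2
    exact h2
  have hN2 : N = 0 := by linarith
  have := hk 0 (by norm_num) T ⟨hT, le_rfl⟩
  rw [hN2] at this
  simpa using this

/-- Laplace-type integral -/
def Lap (g : ℝ → ℝ) (r : ℝ) : ℂ :=
  ∫ Z in Ioi (0:ℝ), Complex.exp (-((1 + Complex.I) * r * Z)) * (g Z : ℂ)

lemma norm_cexp_lap (r Z : ℝ) : ‖Complex.exp (-((1 + Complex.I) * r * Z))‖ = exp (-(r * Z)) := by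
  rw [Complex.norm_exp]
  simp

lemma integrable_lap (g : ℝ → ℝ) (hg : IntegrableOn g (Ioi 0)) (r : ℝ) (hr : 0 ≤ r) :
    IntegrableOn (fun Z : ℝ => Complex.exp (-((1 + Complex.I) * r * Z)) * (g Z : ℂ)) (Ioi 0) := by
  refine Integrable.mono' hg.norm ?_ ?_
  · exact (Continuous.aestronglyMeasurable (by fun_prop)).mul
      (Complex.continuous_ofReal.comp_aestronglyMeasurable hg.aestronglyMeasurable)
  · refine (ae_restrict_iff' measurableSet_Ioi).2 (Eventually.of_forall fun x hx => ?_)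
    rw [norm_mul, norm_cexp_lap, Complex.norm_real]
    refine mul_le_of_le_one_left (norm_nonneg _) (exp_le_one_iff.2 ?_)
    have : 0 ≤ r * x := mul_nonneg hr (le_of_lt hx)
    linarith

lemma norm_lap_le (g : ℝ → ℝ) (hg : IntegrableOn g (Ioi 0)) (r : ℝ) (hr : 0 ≤ r) :
    ‖Lap g r‖ ≤ ∫ Z in Ioi (0:ℝ), ‖g Z‖ := by
  refine norm_integral_le_of_norm_le hg.norm ?_
  refine (ae_restrict_iff' measurableSet_Ioi).2 (Eventually.of_forall fun x hx => ?_)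
  rw [norm_mul, norm_cexp_lap, Complex.norm_real]
  refine mul_le_of_le_one_left (norm_nonneg _) (exp_le_one_iff.2 ?_)
  have : 0 ≤ r * x := mul_nonneg hr (le_of_lt hx)
  linarith

lemma tendsto_lap (g : ℝ → ℝ) (hg : IntegrableOn g (Ioi 0)) :
    Tendsto (Lap g) atTop (nhds 0) := by
  have : Tendsto (Lap g) atTop (nhds (∫ Z in Ioi (0:ℝ), (0:ℂ))) := by
    refine tendsto_integral_filter_of_dominated_convergence (fun Z => ‖g Z‖) ?_ ?_ hg.norm ?_
    · filter_upwards [eventually_ge_atTop 0] with r hr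
      exact (integrable_lap g hg r hr).aestronglyMeasurable
    · filter_upwards [eventually_ge_atTop 0] with r hr
      refine (ae_restrict_iff' measurableSet_Ioi).2 (Eventually.of_forall fun x hx => ?_)
      rw [norm_mul, norm_cexp_lap, Complex.norm_real]
      refine mul_le_of_le_one_left (norm_nonneg _) (exp_le_one_iff.2 ?_)
      have : 0 ≤ r * x := mul_nonneg hr (le_of_lt hx)
      linarith
    · refine (ae_restrict_iff' measurableSet_Ioi).2 (Eventually.of_forall fun x hx => ?_)
      rw [tendsto_zero_iff_norm_tendsto_zero]
      simp only [norm_mul, norm_cexp_lap]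
      rw [show (0:ℝ) = 0 * ‖(g x : ℂ)‖ by simp]
      refine Tendsto.mul_const _ ?_
      refine Real.tendsto_exp_neg_atTop_nhds_zero.comp ?_
      exact tendsto_id.atTop_mul_const hx
  simpa using this

lemma lap_deriv (g g' : ℝ → ℝ) (hd : ∀ x, HasDerivAt g (g' x) x) (hg : IntegrableOn g (Ioi 0))
    (hg' : IntegrableOn g' (Ioi 0)) (r : ℝ) (hr : 0 ≤ r) :
    Lap g' r = (1 + Complex.I) * r * Lap g r - g 0 := by
  set p : ℂ := (1 + Complex.I) * r with hp
  have h1 : ∀ x : ℝ, HasDerivAt (fun Z : ℝ => Complex.exp (-(p * Z)) * (g Z : ℂ))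
      (Complex.exp (-(p * x)) * (g' x : ℂ) - p * (Complex.exp (-(p * x)) * (g x : ℂ))) x := by
    intro x
    have ha : HasDerivAt (fun Z : ℝ => -(p * (Z : ℂ))) (-(p * 1)) x :=
      ((Complex.ofRealCLM.hasDerivAt (x := x)).const_mul p).neg
    have := ha.cexp.mul (hd x).ofReal_comp
    refine this.congr_deriv ?_
    ring
  have i0 := integrable_lap g hg r hr
  have i1 := integrable_lap g' hg' r hr
  have i2 := i1.sub (i0.const_mul p)
  have ht := tendsto_zero_of_hasDerivAt_of_integrableOn_Ioi (a := (0:ℝ)) (fun x _ => h1 x) i2 i0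
  have := integral_Ioi_of_hasDerivAt_of_tendsto (a := (0:ℝ)) (h1 0).continuousAt.continuousWithinAt
    (fun x _ => h1 x) i2 ht
  rw [integral_sub i1 (i0.const_mul p), integral_const_mul] at this
  simp only [Complex.ofReal_zero, mul_zero, neg_zero, Complex.exp_zero, one_mul, zero_sub] at this
  unfold Lap
  linear_combination this

lemma hasDerivAt_lap (g k : ℝ → ℝ) (hg : IntegrableOn g (Ioi 0)) (hk : IntegrableOn k (Ioi 0))
    (hgk : ∀ Z > 0, Z * g Z = k Z) (r : ℝ) (hr : 0 < r) :
    HasDerivAt (Lap g) (-(1 + Complex.I) * Lap k r) r := by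
  have := (hasDerivAt_integral_of_dominated_loc_of_deriv_le (𝕜 := ℝ) (μ := volume.restrict (Ioi (0:ℝ)))
    (F := fun r Z => Complex.exp (-((1 + Complex.I) * r * Z)) * (g Z : ℂ))
    (F' := fun r Z => -(1 + Complex.I) * (Complex.exp (-((1 + Complex.I) * r * Z)) * (k Z : ℂ)))
    (bound := fun Z => ‖(1 + Complex.I)‖ * ‖k Z‖) (x₀ := r)
    (Ioi_mem_nhds hr) ?_ (integrable_lap g hg r hr.le) 
    ((integrable_lap k hk r hr.le).const_mul _).aestronglyMeasurable ?_ (hk.norm.const_mul _) ?_).2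
  · rw [integral_const_mul] at this
    exact this
  · filter_upwards [Ioi_mem_nhds hr] with r hr
    exact (integrable_lap g hg r (le_of_lt hr)).aestronglyMeasurable
  · refine (ae_restrict_iff' measurableSet_Ioi).2 (Eventually.of_forall fun x hx r hr => ?_)
    rw [norm_mul, norm_mul, norm_cexp_lap, Complex.norm_real, norm_neg]
    gcongr
    refine mul_le_of_le_one_left (norm_nonneg _) (exp_le_one_iff.2 ?_)
    have : 0 ≤ r * x := mul_nonneg (le_of_lt hr) (le_of_lt hx)
    linarith
  · refine (ae_restrict_iff' measurableSet_Ioi).2 (Eventually.of_forall fun x hx r hr => ?_)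
    have ha : HasDerivAt (fun r : ℝ => -((1 + Complex.I) * (r:ℂ) * (x : ℂ))) (-((1 + Complex.I) * 1 * x)) r :=
      (((Complex.ofRealCLM.hasDerivAt (x := r)).const_mul (1 + Complex.I)).mul_const (x:ℂ)).neg
    have := ha.cexp.mul_const (g x : ℂ)
    refine this.congr_deriv ?_
    rw [← hgk x hx]
    push_cast
    ring

/-- the linear relation between initial data of integrable smooth solutions -/
lemma data_relation (f : ℕ → ℝ → ℝ) (hf : ∀ k x, HasDerivAt (f k) (f (k+1) x) x)
    (hode : ∀ Z > (0:ℝ), Z * f 5 Z + 4 * f 0 Z = 0) (h00 : f 0 0 = 0)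
    (hint : ∀ k ≤ 4, IntegrableOn (f k) (Ioi 0)) :
    ∃ c1 > (0:ℝ), ∃ c2 > (0:ℝ), ∃ c3 > (0:ℝ), ∃ c4 > (0:ℝ),
      -2 * (f 1 0 * c1) + f 3 0 * c3 + f 4 0 * c4 = 0 ∧
      2 * (f 1 0 * c1) + 2 * (f 2 0 * c2) + f 3 0 * c3 = 0 := by
  have hcont : ∀ k, Continuous (f k) := fun k =>
    continuous_iff_continuousAt.2 fun x => (hf k x).continuousAt
  have hint5 : IntegrableOn (f 5) (Ioi 0) := by
    rw [← Ioc_union_Ioi_eq_Ioi (zero_le_one' ℝ)]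
    refine IntegrableOn.union ?_ ?_
    · exact ((hcont 5).integrableOn_Icc).mono_set Ioc_subset_Icc_self
    · refine Integrable.mono' (((hint 0 (by norm_num)).mono_set
        (Ioi_subset_Ioi zero_le_one)).norm.const_mul 4) (hcont 5).aestronglyMeasurable ?_
      refine (ae_restrict_iff' measurableSet_Ioi).2 (Eventually.of_forall fun x hx => ?_)
      have hx : (1:ℝ) < x := hx
      have h2 : x * |f 5 x| = 4 * |f 0 x| := by
        have : x * f 5 x = -(4 * f 0 x) := by linarith [hode x (by linarith)]
        calc x * |f 5 x| = |x * f 5 x| := by rw [abs_mul, abs_of_pos (show (0:ℝ) < x by linarith)]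
          _ = 4 * |f 0 x| := by rw [this, abs_neg, abs_mul]; norm_num
      simp only [Real.norm_eq_abs]
      nlinarith [abs_nonneg (f 5 x)]
  let a : ℕ → ℂ := fun k => (f k 0 : ℂ)
  let ω : ℂ := 1 + Complex.I
  have hω2 : ω ^ 2 = 2 * Complex.I := by
    simp only [ω]; linear_combination Complex.I_sq
  have hω4 : ω ^ 4 = -4 := by
    rw [show ω ^ 4 = (ω ^ 2) ^ 2 by ring, hω2]; linear_combination 4 * Complex.I_sq
  have hparts : ∀ r ≥ (0:ℝ), Lap (f 5) r = -4 * ω * r ^ 5 * Lap (f 0) r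
      - (a 1 * ω ^ 3 * r ^ 3 + a 2 * ω ^ 2 * r ^ 2 + a 3 * ω * r + a 4) := by
    intro r hr
    rw [lap_deriv (f 4) (f 5) (hf 4) (hint 4 (by norm_num)) hint5 r hr,
      lap_deriv (f 3) (f 4) (hf 3) (hint 3 (by norm_num)) (hint 4 (by norm_num)) r hr,
      lap_deriv (f 2) (f 3) (hf 2) (hint 2 (by norm_num)) (hint 3 (by norm_num)) r hr,
      lap_deriv (f 1) (f 2) (hf 1) (hint 1 (by norm_num)) (hint 2 (by norm_num)) r hr,
      lap_deriv (f 0) (f 1) (hf 0) (hint 0 (by norm_num)) (hint 1 (by norm_num)) r hr, h00]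
    simp only [a]
    change ω * r * (ω * r * (ω * r * (ω * r * (ω * r * Lap (f 0) r - (0:ℝ)) - _) - _) - _) - _ = _
    rw [show ω * r * (ω * r * (ω * r * (ω * r * (ω * r * Lap (f 0) r - (0:ℝ)) - f 1 0) - f 2 0) - f 3 0)
      = ω ^ 4 * ω * r ^ 5 * Lap (f 0) r - (f 1 0 * ω ^ 3 * r ^ 3 + f 2 0 * ω ^ 2 * r ^ 2 + f 3 0 * ω * r)
        by push_cast; ring, hω4]
    ring
  let E : ℝ → ℝ := fun x => exp (-(1/4) * exp (-4 * x))
  have hE : ∀ x, HasDerivAt E (exp (-4 * x) * E x) x := by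
    intro x
    have := ((((hasDerivAt_id x).const_mul (-4)).exp).const_mul (-(1/4 : ℝ))).exp
    refine this.congr_deriv ?_
    simp only [E, id]; ring
  let K : ℝ → ℂ := fun x => Lap (f 5) (exp x) * (E x : ℂ)
  let K' : ℝ → ℂ := fun x => -((a 1 * ω ^ 3) * (exp (-1 * x - 1/4 * exp (-4 * x)) : ℝ)
    + (a 2 * ω ^ 2) * (exp (-2 * x - 1/4 * exp (-4 * x)) : ℝ)
    + (a 3 * ω) * (exp (-3 * x - 1/4 * exp (-4 * x)) : ℝ)
    + (a 4) * (exp (-4 * x - 1/4 * exp (-4 * x)) : ℝ))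
  have hK : ∀ x, HasDerivAt K (K' x) x := by
    intro x
    have h1 := hasDerivAt_lap (f 5) (fun Z => -4 * f 0 Z) hint5 ((hint 0 (by norm_num)).const_mul _)
      (fun Z hZ => by linarith [hode Z hZ]) (exp x) (exp_pos x)
    have hl : Lap (fun Z => -4 * f 0 Z) (exp x) = -4 * Lap (f 0) (exp x) := by
      unfold Lap
      rw [← integral_const_mul]
      congr 1; ext Z; push_cast; ring
    rw [hl] at h1
    have h2 := (h1.scomp x (Real.hasDerivAt_exp x)).mul (hE x).ofReal_comp
    refine h2.congr_deriv ?_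
    simp only [Function.comp, K', Complex.real_smul]
    rw [hparts _ (exp_pos x).le]
    have e : ∀ y : ℝ, exp (y - 1/4 * exp (-4 * x)) = exp y * E x := by
      intro y; simp only [E]; rw [← Real.exp_add]; congr 1; ring
    rw [e, e, e, e]
    have en : exp (-1 * x) = (exp x)⁻¹ := by rw [← Real.exp_neg]; congr 1; ring
    have en2 : exp (-2 * x) = (exp x)⁻¹ ^ 2 := by rw [← Real.exp_neg, ← Real.exp_nat_mul]; congr 1; push_cast; ring
    have en3 : exp (-3 * x) = (exp x)⁻¹ ^ 3 := by rw [← Real.exp_neg, ← Real.exp_nat_mul]; congr 1; push_cast; ring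
    have en4 : exp (-4 * x) = (exp x)⁻¹ ^ 4 := by rw [← Real.exp_neg, ← Real.exp_nat_mul]; congr 1; push_cast; ring
    rw [en, en2, en3, en4]
    have hne : ((exp x : ℝ) : ℂ) ≠ 0 := Complex.ofReal_ne_zero.2 (exp_pos x).ne'
    push_cast at hne ⊢
    simp only [ω]
    field_simp
    ring
  have I1 := integrable_neg_sub_exp 1 (1/4) (by norm_num) (by norm_num)
  have I2 := integrable_neg_sub_exp 2 (1/4) (by norm_num) (by norm_num)
  have I3 := integrable_neg_sub_exp 3 (1/4) (by norm_num) (by norm_num)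
  have I4 := integrable_neg_sub_exp 4 (1/4) (by norm_num) (by norm_num)
  have J1 := I1.ofReal (𝕜 := ℂ) |>.const_mul (a 1 * ω ^ 3)
  have J2 := I2.ofReal (𝕜 := ℂ) |>.const_mul (a 2 * ω ^ 2)
  have J3 := I3.ofReal (𝕜 := ℂ) |>.const_mul (a 3 * ω)
  have J4 := I4.ofReal (𝕜 := ℂ) |>.const_mul (a 4)
  have hK'int : Integrable K' := (((J1.add J2).add J3).add J4).neg
  have hbd : ∀ x, ‖Lap (f 5) (exp x)‖ ≤ ∫ Z in Ioi (0:ℝ), ‖f 5 Z‖ := fun x =>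
    norm_lap_le _ hint5 _ (exp_pos x).le
  have hbot : Tendsto K atBot (nhds 0) := by
    have hE0 : Tendsto E atBot (nhds 0) := by
      refine Real.tendsto_exp_atBot.comp ?_
      refine Tendsto.const_mul_atTop_of_neg (by norm_num) ?_
      refine Real.tendsto_exp_atTop.comp ?_
      exact Tendsto.const_mul_atBot_of_neg (by norm_num) tendsto_id
    refine squeeze_zero_norm (a := fun x => (∫ Z in Ioi (0:ℝ), ‖f 5 Z‖) * E x) (fun x => ?_) ?_
    · simp only [K]
      rw [norm_mul, Complex.norm_real, Real.norm_eq_abs, abs_of_pos (exp_pos _)]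
      exact mul_le_mul_of_nonneg_right (hbd x) (exp_pos _).le
    · simpa using hE0.const_mul (∫ Z in Ioi (0:ℝ), ‖f 5 Z‖)
  have htop : Tendsto K atTop (nhds 0) := by
    have h1 := (tendsto_lap (f 5) hint5).comp Real.tendsto_exp_atTop
    refine squeeze_zero_norm (a := fun x => ‖Lap (f 5) (exp x)‖) (fun x => ?_) (by simpa using h1.norm)
    simp only [K]
    rw [norm_mul, Complex.norm_real, Real.norm_eq_abs, abs_of_pos (exp_pos _)]
    refine mul_le_of_le_one_right (norm_nonneg _) (exp_le_one_iff.2 ?_)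
    have := exp_pos (-4 * x)
    linarith
  have hmain := integral_of_hasDerivAt_of_tendsto hK hK'int hbot htop
  have hsplit : ∫ x, K' x = -((a 1 * ω ^ 3) * (∫ x, exp (-1 * x - 1/4 * exp (-4 * x)) : ℝ)
    + (a 2 * ω ^ 2) * (∫ x, exp (-2 * x - 1/4 * exp (-4 * x)) : ℝ)
    + (a 3 * ω) * (∫ x, exp (-3 * x - 1/4 * exp (-4 * x)) : ℝ)
    + (a 4) * (∫ x, exp (-4 * x - 1/4 * exp (-4 * x)) : ℝ)) := by
    have s1 := integral_add J1 J2
    have s2 := integral_add (J1.add J2) J3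
    have s3 := integral_add ((J1.add J2).add J3) J4
    have s4 := (integral_neg (μ := volume) (fun x : ℝ => -K' x)).trans (congrArg Neg.neg
      ((by simp only [K', neg_neg]; rfl : ∫ x, -K' x = _).trans
        (s3.trans (congrArg₂ (· + ·) (s2.trans (congrArg₂ (· + ·) s1 rfl)) rfl))))
    simp only [neg_neg, integral_const_mul, RCLike.ofReal_eq_complex_ofReal] at s4
    rw [s4, ← integral_complex_ofReal, ← integral_complex_ofReal, ← integral_complex_ofReal,
      ← integral_complex_ofReal]
  have P1 := integral_exp_pos I1
  have P2 := integral_exp_pos I2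
  have P3 := integral_exp_pos I3
  have P4 := integral_exp_pos I4
  rw [hsplit, show ω ^ 3 = ω ^ 2 * ω by ring, hω2] at hmain
  clear hsplit
  generalize (∫ x, exp (-1 * x - 1/4 * exp (-4 * x)) : ℝ) = c1 at *
  generalize (∫ x, exp (-2 * x - 1/4 * exp (-4 * x)) : ℝ) = c2 at *
  generalize (∫ x, exp (-3 * x - 1/4 * exp (-4 * x)) : ℝ) = c3 at *
  generalize (∫ x, exp (-4 * x - 1/4 * exp (-4 * x)) : ℝ) = c4 at *
  refine ⟨_, P1, _, P2, _, P3, _, P4, ?_⟩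
  have hre := congrArg Complex.re hmain
  have him := congrArg Complex.im hmain
  simp [a, ω] at hre him
  constructor <;> linarith


/-! ### Existence: contour integral in logarithmic coordinates -/

/-- the integrand -/
def hh (N Z : ℝ) (w : ℂ) : ℂ :=
  Complex.exp (N * w - Complex.exp (-4 * w) + Z * Complex.exp w)

/-- the point `x + iθ` -/
def pt (x θ : ℝ) : ℂ := (x : ℂ) + (θ : ℂ) * Complex.I

/-- the contour integral -/
def TT (X N Z : ℝ) : ℂ :=
  (∫ x in Iic X, hh N Z (pt x π)) - (∫ x in Iic X, hh N Z (pt x (π / 2)))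
    - Complex.I * ∫ θ in (π / 2)..π, hh N Z (pt X θ)

lemma continuous_hh (N Z : ℝ) : Continuous (hh N Z) := by
  unfold hh; fun_prop

lemma continuous_pt_left (θ : ℝ) : Continuous (fun x => pt x θ) := by
  unfold pt; fun_prop

lemma continuous_pt_right (x : ℝ) : Continuous (fun θ => pt x θ) := by
  unfold pt; fun_prop

lemma norm_hh (N Z x θ : ℝ) :
    ‖hh N Z (pt x θ)‖ = exp (N * x - exp (-4 * x) * cos (4 * θ) + Z * exp x * cos θ) := by
  unfold hh pt
  rw [Complex.norm_exp]
  congr 1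
  simp [Complex.exp_re, mul_assoc]

lemma hasDerivAt_hh (N Z : ℝ) (w : ℂ) :
    HasDerivAt (hh N Z) (N * hh N Z w + 4 * hh (N - 4) Z w + Z * hh (N + 1) Z w) w := by
  have h1 : HasDerivAt (fun w : ℂ => (N:ℂ) * w - Complex.exp (-4 * w) + Z * Complex.exp w)
      (N * 1 - Complex.exp (-4 * w) * (-4 * 1) + Z * Complex.exp w) w :=
    (((hasDerivAt_id w).const_mul (N:ℂ)).sub ((hasDerivAt_id w).const_mul (-4)).cexp).add
      ((Complex.hasDerivAt_exp w).const_mul (Z:ℂ))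
  refine h1.cexp.congr_deriv ?_
  have e1 : hh (N - 4) Z w = hh N Z w * Complex.exp (-4 * w) := by
    unfold hh; rw [← Complex.exp_add]; congr 1; push_cast; ring
  have e2 : hh (N + 1) Z w = hh N Z w * Complex.exp w := by
    unfold hh; rw [← Complex.exp_add]; congr 1; push_cast; ring
  rw [e1, e2]
  unfold hh
  ring

lemma hasDerivAt_hh_Z (N : ℝ) (w : ℂ) (Z : ℝ) :
    HasDerivAt (fun Z : ℝ => hh N Z w) (hh (N + 1) Z w) Z := by
  have h1 : HasDerivAt (fun Z : ℝ => (N:ℂ) * w - Complex.exp (-4 * w) + (Z:ℂ) * Complex.exp w)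
      (1 * Complex.exp w) Z :=
    ((Complex.ofRealCLM.hasDerivAt (x := Z)).mul_const (Complex.exp w)).const_add _
  refine h1.cexp.congr_deriv ?_
  unfold hh
  rw [one_mul, ← Complex.exp_add]; congr 1; push_cast; ring

lemma norm_hh_ray_le (N Z M X x θ : ℝ) (hθ : cos (4 * θ) = 1) (hM : |Z| ≤ M) (hx : x ≤ X) :
    ‖hh N Z (pt x θ)‖ ≤ exp (M * exp X) * exp (N * x - 1 * exp (-4 * x)) := by
  rw [norm_hh, hθ, ← Real.exp_add]
  apply exp_le_exp.2
  have : Z * exp x * cos θ ≤ M * exp X := by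
    calc Z * exp x * cos θ ≤ |Z * exp x * cos θ| := le_abs_self _
      _ = |Z| * exp x * |cos θ| := by rw [abs_mul, abs_mul, abs_of_pos (exp_pos x)]
      _ ≤ |Z| * exp x * 1 := mul_le_mul_of_nonneg_left (abs_cos_le_one θ) (by positivity)
      _ = |Z| * exp x := mul_one _
      _ ≤ M * exp X := mul_le_mul hM (exp_le_exp.2 hx) (exp_pos _).le ((abs_nonneg _).trans hM)
  linarith

lemma integrable_hh_ray (N Z X θ : ℝ) (hθ : cos (4 * θ) = 1) :
    IntegrableOn (fun x => hh N Z (pt x θ)) (Iic X) := by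
  refine Integrable.mono' ((integrableOn_lin_sub_exp N X 1 one_pos).const_mul (exp (|Z| * exp X)))
    ((continuous_hh N Z).comp (continuous_pt_left θ)).aestronglyMeasurable ?_
  refine (ae_restrict_iff' measurableSet_Iic).2 (Eventually.of_forall fun x hx => ?_)
  exact norm_hh_ray_le N Z |Z| X x θ hθ le_rfl hx

lemma abs_le_of_mem_Ioo {Z y : ℝ} (hy : y ∈ Ioo (Z - 1) (Z + 1)) : |y| ≤ |Z| + 1 := by
  have h1 := le_abs_self Z
  have h2 := neg_abs_le Z
  rw [abs_le]; constructor <;> linarith [hy.1, hy.2]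

lemma hasDerivAt_ray (N Z X θ : ℝ) (hθ : cos (4 * θ) = 1) :
    HasDerivAt (fun Z => ∫ x in Iic X, hh N Z (pt x θ)) (∫ x in Iic X, hh (N + 1) Z (pt x θ)) Z := by
  refine (hasDerivAt_integral_of_dominated_loc_of_deriv_le (𝕜 := ℝ) (μ := volume.restrict (Iic X))
    (F := fun Z x => hh N Z (pt x θ)) (F' := fun Z x => hh (N + 1) Z (pt x θ))
    (bound := fun x => exp ((|Z| + 1) * exp X) * exp ((N + 1) * x - 1 * exp (-4 * x))) (x₀ := Z)
    (Ioo_mem_nhds (show Z - 1 < Z by linarith) (show Z < Z + 1 by linarith)) ?_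
    (integrable_hh_ray N Z X θ hθ)
    (integrable_hh_ray (N + 1) Z X θ hθ).aestronglyMeasurable ?_
    ((integrableOn_lin_sub_exp (N + 1) X 1 one_pos).const_mul _) ?_).2
  · exact Eventually.of_forall fun y => (integrable_hh_ray N y X θ hθ).aestronglyMeasurable
  · refine (ae_restrict_iff' measurableSet_Iic).2 (Eventually.of_forall fun x hx y hy => ?_)
    exact norm_hh_ray_le (N + 1) y _ X x θ hθ (abs_le_of_mem_Ioo hy) hx
  · exact Eventually.of_forall fun x y _ => hasDerivAt_hh_Z N _ y

lemma norm_hh_arc_le (N Z M X θ : ℝ) (hM : |Z| ≤ M) :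
    ‖hh N Z (pt X θ)‖ ≤ exp (N * X + exp (-4 * X) + M * exp X) := by
  rw [norm_hh]
  apply exp_le_exp.2
  have h1 : Z * exp X * cos θ ≤ M * exp X := by
    calc Z * exp X * cos θ ≤ |Z * exp X * cos θ| := le_abs_self _
      _ = |Z| * exp X * |cos θ| := by rw [abs_mul, abs_mul, abs_of_pos (exp_pos X)]
      _ ≤ |Z| * exp X * 1 := mul_le_mul_of_nonneg_left (abs_cos_le_one θ) (by positivity)
      _ = |Z| * exp X := mul_one _
      _ ≤ M * exp X := by gcongr
  have h2 : -1 ≤ cos (4 * θ) := neg_one_le_cos _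
  nlinarith [exp_pos (-4 * X)]

lemma hasDerivAt_arc (N Z X a b : ℝ) :
    HasDerivAt (fun Z => ∫ θ in a..b, hh N Z (pt X θ)) (∫ θ in a..b, hh (N + 1) Z (pt X θ)) Z := by
  have hc : ∀ N Z, Continuous (fun θ => hh N Z (pt X θ)) := fun N Z =>
    (continuous_hh N Z).comp (continuous_pt_right X)
  refine (intervalIntegral.hasDerivAt_integral_of_dominated_loc_of_deriv_le (𝕜 := ℝ) (μ := volume)
    (F := fun Z θ => hh N Z (pt X θ)) (F' := fun Z θ => hh (N + 1) Z (pt X θ))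
    (bound := fun _ => exp ((N + 1) * X + exp (-4 * X) + (|Z| + 1) * exp X)) (x₀ := Z)
    (Ioo_mem_nhds (show Z - 1 < Z by linarith) (show Z < Z + 1 by linarith)) ?_
    ((hc N Z).intervalIntegrable _ _) (hc _ _).aestronglyMeasurable ?_
    intervalIntegrable_const ?_).2
  · exact Eventually.of_forall fun y => (hc _ _).aestronglyMeasurable
  · exact Eventually.of_forall fun θ _ y hy => norm_hh_arc_le (N + 1) y _ X θ (abs_le_of_mem_Ioo hy)
  · exact Eventually.of_forall fun x _ y _ => hasDerivAt_hh_Z N _ y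

lemma cos_four_pi : cos (4 * π) = 1 := by
  rw [show 4 * π = ((2 : ℕ) : ℝ) * (2 * π) by push_cast; ring]; exact cos_nat_mul_two_pi 2

lemma cos_four_half_pi : cos (4 * (π / 2)) = 1 := by
  rw [show 4 * (π / 2) = 2 * π by ring]; exact cos_two_pi

lemma hasDerivAt_TT (X N Z : ℝ) : HasDerivAt (TT X N) (TT X (N + 1) Z) Z :=
  ((hasDerivAt_ray N Z X π cos_four_pi).sub (hasDerivAt_ray N Z X (π / 2) cos_four_half_pi)).sub
    ((hasDerivAt_arc N Z X (π / 2) π).const_mul Complex.I)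

/-- derivative of the integrand -/
def hd (N Z : ℝ) (w : ℂ) : ℂ := N * hh N Z w + 4 * hh (N - 4) Z w + Z * hh (N + 1) Z w

lemma continuous_hd (N Z : ℝ) : Continuous (hd N Z) := by
  have := continuous_hh N Z
  have := continuous_hh (N - 4) Z
  have := continuous_hh (N + 1) Z
  unfold hd; fun_prop

lemma integrable_hd_ray (N Z X θ : ℝ) (hθ : cos (4 * θ) = 1) :
    IntegrableOn (fun x => hd N Z (pt x θ)) (Iic X) :=
  (((integrable_hh_ray N Z X θ hθ).const_mul _).add
    ((integrable_hh_ray (N - 4) Z X θ hθ).const_mul _)).add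
    ((integrable_hh_ray (N + 1) Z X θ hθ).const_mul _)

lemma integral_hd_ray (N Z X θ : ℝ) (hθ : cos (4 * θ) = 1) :
    ∫ x in Iic X, hd N Z (pt x θ) = hh N Z (pt X θ) := by
  have h1 : ∀ x : ℝ, HasDerivAt (fun x => hh N Z (pt x θ)) (hd N Z (pt x θ)) x := by
    intro x
    have ha : HasDerivAt (fun x : ℝ => pt x θ) 1 x :=
      (Complex.ofRealCLM.hasDerivAt (x := x)).add_const _
    have := (hasDerivAt_hh N Z (pt x θ)).comp x ha
    rw [mul_one] at this
    exact this
  have ht := tendsto_zero_of_hasDerivAt_of_integrableOn_Iic (a := X) (fun x _ => h1 x)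
    (integrable_hd_ray N Z X θ hθ) (integrable_hh_ray N Z X θ hθ)
  rw [integral_Iic_of_hasDerivAt_of_tendsto (h1 X).continuousAt.continuousWithinAt (fun x _ => h1 x)
    (integrable_hd_ray N Z X θ hθ) ht, sub_zero]

lemma integral_hd_ray' (N Z X θ : ℝ) (hθ : cos (4 * θ) = 1) :
    ∫ x in Iic X, hd N Z (pt x θ) = N * (∫ x in Iic X, hh N Z (pt x θ))
      + 4 * (∫ x in Iic X, hh (N - 4) Z (pt x θ)) + Z * (∫ x in Iic X, hh (N + 1) Z (pt x θ)) := by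
  have i1 := (integrable_hh_ray N Z X θ hθ).const_mul (N:ℂ)
  have i2 := (integrable_hh_ray (N - 4) Z X θ hθ).const_mul (4:ℂ)
  have i3 := (integrable_hh_ray (N + 1) Z X θ hθ).const_mul (Z:ℂ)
  have s1 := integral_add i1 i2
  have s2 := (integral_add (i1.add i2) i3).trans (congrArg₂ (· + ·) s1 rfl)
  simp only [integral_const_mul] at s2
  exact s2

lemma integral_hd_arc (N Z X a b : ℝ) :
    Complex.I * ∫ θ in a..b, hd N Z (pt X θ) = hh N Z (pt X b) - hh N Z (pt X a) := by
  have h1 : ∀ θ : ℝ, HasDerivAt (fun θ => hh N Z (pt X θ)) (Complex.I * hd N Z (pt X θ)) θ := by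
    intro θ
    have ha : HasDerivAt (fun θ : ℝ => pt X θ) (1 * Complex.I) θ :=
      ((Complex.ofRealCLM.hasDerivAt (x := θ)).mul_const Complex.I).const_add _
    have := (hasDerivAt_hh N Z (pt X θ)).comp θ ha
    rw [one_mul, mul_comm] at this
    exact this
  rw [← intervalIntegral.integral_const_mul]
  refine intervalIntegral.integral_eq_sub_of_hasDerivAt (fun θ _ => h1 θ) ?_
  exact (continuous_const.mul ((continuous_hd N Z).comp (continuous_pt_right X))).intervalIntegrable _ _

lemma integral_hd_arc' (N Z X a b : ℝ) :
    ∫ θ in a..b, hd N Z (pt X θ) = N * (∫ θ in a..b, hh N Z (pt X θ))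
      + 4 * (∫ θ in a..b, hh (N - 4) Z (pt X θ)) + Z * (∫ θ in a..b, hh (N + 1) Z (pt X θ)) := by
  have hc : ∀ N Z, IntervalIntegrable (fun θ => hh N Z (pt X θ)) volume a b := fun N Z =>
    ((continuous_hh N Z).comp (continuous_pt_right X)).intervalIntegrable _ _
  have i1 := (hc N Z).const_mul (N:ℂ)
  have i2 := (hc (N - 4) Z).const_mul (4:ℂ)
  have i3 := (hc (N + 1) Z).const_mul (Z:ℂ)
  have s1 := intervalIntegral.integral_add i1 i2
  have s2 := (intervalIntegral.integral_add (i1.add i2) i3).trans (congrArg₂ (· + ·) s1 rfl)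
  simp only [intervalIntegral.integral_const_mul] at s2
  exact s2

lemma TT_rec (X N Z : ℝ) : N * TT X N Z + 4 * TT X (N - 4) Z + Z * TT X (N + 1) Z = 0 := by
  have r1 := (integral_hd_ray' N Z X π cos_four_pi).symm.trans (integral_hd_ray N Z X π cos_four_pi)
  have r2 := (integral_hd_ray' N Z X (π/2) cos_four_half_pi).symm.trans
    (integral_hd_ray N Z X (π/2) cos_four_half_pi)
  have r3 := integral_hd_arc N Z X (π/2) π
  rw [integral_hd_arc'] at r3
  unfold TT
  linear_combination r1 - r2 - r3

/-- independence of the radius -/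
lemma TT_indep (X Y N Z : ℝ) : TT X N Z = TT Y N Z := by
  have h := Complex.integral_boundary_rect_eq_zero_of_differentiableOn (hh N Z) (pt Y (π/2)) (pt X π)
    (fun w _ => (hasDerivAt_hh N Z w).differentiableAt.differentiableWithinAt)
  have e1 := intervalIntegral.integral_Iic_sub_Iic (integrable_hh_ray N Z Y π cos_four_pi)
    (integrable_hh_ray N Z X π cos_four_pi)
  have e2 := intervalIntegral.integral_Iic_sub_Iic (integrable_hh_ray N Z Y (π/2) cos_four_half_pi)
    (integrable_hh_ray N Z X (π/2) cos_four_half_pi)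
  have p1 : ∀ x θ, (pt x θ).re = x := by intro x θ; simp [pt]
  have p2 : ∀ x θ, (pt x θ).im = θ := by intro x θ; simp [pt]
  rw [p1, p1, p2, p2] at h
  simp only [smul_eq_mul] at h
  unfold TT
  simp only [pt] at e1 e2 h ⊢
  linear_combination e1 - e2 - h


lemma TT_decay (X₀ N : ℝ) : ∃ C : ℝ, 0 ≤ C ∧ ∀ Z ≥ (1:ℝ),
    ‖TT X₀ N Z‖ ≤ C * exp (-(1/32) * Z ^ ((4:ℝ)/5)) := by
  obtain ⟨B, hB⟩ := lin_sub_exp_le N (Real.log 2) (1/2) (by norm_num)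
  have hI := integrableOn_lin_sub_exp N (Real.log 2) (1/2) (by norm_num)
  set A := ∫ x in Iic (Real.log 2), exp (N * x - 1/2 * exp (-4 * x)) with hA
  have hA0 : 0 ≤ A := integral_nonneg fun x => (exp_pos _).le
  refine ⟨A + A + exp B * (π / 2), by positivity, fun Z hZ => ?_⟩
  have hZ0 : 0 < Z := by linarith
  set X := Real.log 2 - Real.log Z / 5 with hX
  rw [TT_indep X₀ X N Z]
  set Y := Z ^ ((4:ℝ)/5) with hY
  have hlog : 0 ≤ Real.log Z := Real.log_nonneg hZ
  have hXle : X ≤ Real.log 2 := by rw [hX]; linarith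
  have hYe : Y = exp (4 * Real.log Z / 5) := by
    rw [hY, Real.rpow_def_of_pos hZ0]; congr 1; ring
  have e1 : exp (-4 * X) = Y / 16 := by
    rw [hYe, show (16:ℝ) = exp (4 * Real.log 2) by
      rw [show 4 * Real.log 2 = ((4:ℕ):ℝ) * Real.log 2 by push_cast; ring, Real.exp_nat_mul,
        Real.exp_log (by norm_num)]; norm_num, ← Real.exp_sub]
    congr 1; rw [hX]; ring
  have e2 : Z * exp X = 2 * Y := by
    calc Z * exp X = exp (Real.log Z) * exp X := by rw [Real.exp_log hZ0]
      _ = exp (Real.log 2) * exp (4 * Real.log Z / 5) := by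
        rw [← Real.exp_add, ← Real.exp_add]; congr 1; rw [hX]; ring
      _ = 2 * Y := by rw [Real.exp_log (by norm_num), hYe]
  have hY0 : 0 < Y := by rw [hYe]; exact exp_pos _
  have ray : ∀ θ, cos (4 * θ) = 1 → cos θ ≤ 0 →
      ‖∫ x in Iic X, hh N Z (pt x θ)‖ ≤ A * exp (-(1/32) * Y) := by
    intro θ h1 h2
    have hI' := (hI.mono_set (Iic_subset_Iic.2 hXle)).mul_const (exp (-(1/32) * Y))
    refine (norm_integral_le_of_norm_le hI' ?_).trans ?_
    · refine (ae_restrict_iff' measurableSet_Iic).2 (Eventually.of_forall fun x hx => ?_)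
      rw [norm_hh, h1, ← Real.exp_add]
      apply exp_le_exp.2
      have g1 : Y / 16 ≤ exp (-4 * x) := by
        rw [← e1]; apply exp_le_exp.2; have : x ≤ X := hx; linarith
      have g2 : Z * exp x * cos θ ≤ 0 := mul_nonpos_of_nonneg_of_nonpos (by positivity) h2
      linarith
    · rw [integral_mul_const]
      refine mul_le_mul_of_nonneg_right ?_ (exp_pos _).le
      exact setIntegral_mono_set hI (Eventually.of_forall fun x => (exp_pos _).le)
        (Iic_subset_Iic.2 hXle).eventuallyLE
  have arc : ‖∫ θ in (π/2)..π, hh N Z (pt X θ)‖ ≤ exp B * exp (-(1/32) * Y) * |π - π/2| := by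
    refine intervalIntegral.norm_integral_le_of_norm_le_const fun θ hθ => ?_
    rw [uIoc_of_le (by linarith [pi_pos])] at hθ
    rw [norm_hh, ← Real.exp_add]
    apply exp_le_exp.2
    have hc0 : cos θ ≤ 0 := cos_nonpos_of_pi_div_two_le_of_le hθ.1.le (by linarith [hθ.2, pi_pos])
    have hc1 : -1 ≤ cos θ := neg_one_le_cos θ
    have h4 : cos (4 * θ) = 8 * cos θ ^ 4 - 8 * cos θ ^ 2 + 1 := by
      rw [show 4 * θ = 2 * (2 * θ) by ring, cos_two_mul, cos_two_mul]; ring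
    have hb := hB X hXle
    rw [e1] at hb
    rw [e1, e2, h4]
    set c := cos θ
    have : -(8 * c ^ 4 - 8 * c ^ 2 + 1) / 16 + 2 * c ≤ -(1/16) := by
      nlinarith [sq_nonneg (c ^ 2)]
    nlinarith
  have harc : |π - π/2| = π/2 := by rw [abs_of_pos (by linarith [pi_pos])]; ring
  rw [harc] at arc
  unfold TT
  refine (norm_sub_le _ _).trans ?_
  refine (add_le_add ((norm_sub_le _ _).trans (add_le_add (ray π cos_four_pi (by simp))
    (ray (π/2) cos_four_half_pi (by simp)))) ?_).trans_eq
    (b := A * exp (-(1/32) * Y) + A * exp (-(1/32) * Y) + exp B * exp (-(1/32) * Y) * (π/2)) (by ring)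
  rw [norm_mul, Complex.norm_I, one_mul]
  exact arc

lemma integrable_exp_neg_rpow (c : ℝ) (hc : 0 < c) :
    IntegrableOn (fun Z : ℝ => exp (-c * Z ^ ((4:ℝ)/5))) (Ioi 0) := by
  have h := integral_exp_neg_mul_rpow (p := (4:ℝ)/5) (b := c) (by norm_num) hc
  by_contra hn
  have h0 : ∫ Z in Ioi (0:ℝ), exp (-c * Z ^ ((4:ℝ)/5)) = 0 := integral_undef hn
  rw [h0] at h
  have : 0 < c ^ (-1 / ((4:ℝ)/5)) * Gamma (1 / ((4:ℝ)/5) + 1) :=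
    mul_pos (Real.rpow_pos_of_pos hc _) (Real.Gamma_pos_of_pos (by norm_num))
  linarith

lemma weighted_integrable (X₀ N : ℝ) (α : ℂ) :
    IntegrableOn (fun Z => |(α * TT X₀ N Z).re| * exp (1/64 * Z ^ ((4:ℝ)/5))) (Ioi (0:ℝ)) := by
  obtain ⟨C, hC0, hC⟩ := TT_decay X₀ N
  have hcT : Continuous (TT X₀ N) :=
    continuous_iff_continuousAt.2 fun x => (hasDerivAt_TT X₀ N x).continuousAt
  have hc : Continuous (fun Z => |(α * TT X₀ N Z).re| * exp (1/64 * Z ^ ((4:ℝ)/5))) := by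
    have : Continuous (fun Z : ℝ => Z ^ ((4:ℝ)/5)) := continuous_id.rpow_const (fun _ => Or.inr (by norm_num))
    have h2 : Continuous (fun Z => (α * TT X₀ N Z).re) :=
      Complex.continuous_re.comp (continuous_const.mul hcT)
    fun_prop
  rw [← Ioc_union_Ioi_eq_Ioi (zero_le_one' ℝ)]
  refine IntegrableOn.union ?_ ?_
  · exact (hc.integrableOn_Icc).mono_set Ioc_subset_Icc_self
  · refine Integrable.mono' (((integrable_exp_neg_rpow (1/64) (by norm_num)).mono_set
      (Ioi_subset_Ioi zero_le_one)).const_mul (‖α‖ * C)) hc.aestronglyMeasurable ?_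
    refine (ae_restrict_iff' measurableSet_Ioi).2 (Eventually.of_forall fun Z hZ => ?_)
    rw [norm_mul, Real.norm_eq_abs, Real.norm_eq_abs, abs_abs, abs_of_pos (exp_pos _)]
    have h1 := hC Z (le_of_lt hZ)
    calc |(α * TT X₀ N Z).re| * exp (1/64 * Z ^ ((4:ℝ)/5))
        ≤ (‖α‖ * (C * exp (-(1/32) * Z ^ ((4:ℝ)/5)))) * exp (1/64 * Z ^ ((4:ℝ)/5)) := by
          refine mul_le_mul_of_nonneg_right ?_ (exp_pos _).le
          refine (Complex.abs_re_le_norm _).trans ?_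
          rw [norm_mul]
          exact mul_le_mul_of_nonneg_left h1 (norm_nonneg _)
      _ = ‖α‖ * C * (exp (-(1/32) * Z ^ ((4:ℝ)/5)) * exp (1/64 * Z ^ ((4:ℝ)/5))) := by ring
      _ = ‖α‖ * C * exp (-(1/64) * Z ^ ((4:ℝ)/5)) := by
          rw [← Real.exp_add]; congr 2; ring

/-! ### Non-degeneracy -/

lemma exp_neg_four_le : exp (-4 * 20) ≤ 1/64 := by
  rw [show (-4 * 20 : ℝ) = -80 by norm_num, Real.exp_neg, inv_eq_one_div]
  refine one_div_le_one_div_of_le (by norm_num) ?_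
  have := Real.add_one_le_exp (80:ℝ)
  linarith

lemma hh_zero_ray (N x θ : ℝ) (h : Complex.exp (-4 * (θ * Complex.I)) = 1) :
    hh N 0 (pt x θ) = Complex.exp (N * (θ * Complex.I)) * (exp (N * x - 1 * exp (-4 * x)) : ℝ) := by
  have h1 : Complex.exp (-4 * pt x θ) = Complex.exp (-4 * x) := by
    unfold pt
    rw [mul_add, Complex.exp_add, h, mul_one]
  unfold hh
  rw [h1]
  push_cast
  rw [← Complex.exp_add]
  unfold pt
  congr 1; push_cast; ring

lemma exp_four_pi : Complex.exp (-4 * ((π:ℝ) * Complex.I)) = 1 := by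
  rw [Complex.exp_eq_one_iff]; exact ⟨-2, by push_cast; ring⟩

lemma exp_four_half_pi : Complex.exp (-4 * (((π/2 : ℝ):ℝ) * Complex.I)) = 1 := by
  rw [Complex.exp_eq_one_iff]; exact ⟨-1, by push_cast; ring⟩

lemma TT_zero_zero : (TT 20 0 0).im ≤ -1 ∧ |(TT 20 0 0).re| ≤ 1/8 := by
  have h1 : TT 20 0 0 = -Complex.I * ∫ θ in (π/2)..π, hh 0 0 (pt 20 θ) := by
    unfold TT
    simp only [hh_zero_ray 0 _ _ exp_four_pi, hh_zero_ray 0 _ _ exp_four_half_pi]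
    simp
  have h2 : ‖∫ θ in (π/2)..π, (hh 0 0 (pt 20 θ) - 1)‖ ≤ 1/32 * |π - π/2| := by
    refine intervalIntegral.norm_integral_le_of_norm_le_const fun θ _ => ?_
    have e : hh 0 0 (pt 20 θ) = Complex.exp (-Complex.exp (-4 * pt 20 θ)) := by
      unfold hh; simp
    have hn : ‖-Complex.exp (-4 * pt 20 θ)‖ ≤ 1/64 := by
      rw [norm_neg, Complex.norm_exp]
      refine le_trans (le_of_eq ?_) exp_neg_four_le
      congr 1; simp [pt]
    rw [e]
    refine (Complex.norm_exp_sub_one_le (hn.trans (by norm_num))).trans ?_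
    linarith
  have harc : |π - π/2| = π/2 := by rw [abs_of_pos (by linarith [pi_pos])]; ring
  have hci : IntervalIntegrable (fun θ => hh 0 0 (pt 20 θ)) volume (π/2) π :=
    ((continuous_hh 0 0).comp (continuous_pt_right 20)).intervalIntegrable _ _
  have hc1 : IntervalIntegrable (fun _ : ℝ => (1:ℂ)) volume (π/2) π :=
    continuous_const.intervalIntegrable _ _
  rw [harc, intervalIntegral.integral_sub hci hc1] at h2
  set J := ∫ θ in (π/2)..π, hh 0 0 (pt 20 θ)
  have h3 : (∫ _ in (π/2)..π, (1:ℂ)) = ((π/2 : ℝ) : ℂ) := by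
    rw [intervalIntegral.integral_const, Complex.real_smul, mul_one]; congr 1; ring
  rw [h3] at h2
  have hp := pi_le_four
  have hp3 := pi_gt_three
  have h2' : ‖J - ((π/2 : ℝ) : ℂ)‖ ≤ 1/8 := h2.trans (by linarith)
  have a1 := (Complex.abs_re_le_norm _).trans h2'
  have a2 := (Complex.abs_im_le_norm _).trans h2'
  simp only [Complex.sub_re, Complex.sub_im, Complex.ofReal_re, Complex.ofReal_im, sub_zero] at a1 a2
  rw [h1]
  simp only [neg_mul, Complex.neg_im, Complex.neg_re, Complex.I_mul_im, Complex.I_mul_re, neg_neg]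
  rw [abs_le] at a1
  exact ⟨by linarith, a2⟩

lemma TT_zero_ray (N : ℝ) (hN : N ≤ -1) (hN' : -3 ≤ N) (e1 e2 : ℂ)
    (h1 : Complex.exp (N * ((π:ℝ) * Complex.I)) = e1)
    (h2 : Complex.exp (N * (((π/2 : ℝ):ℝ) * Complex.I)) = e2) :
    ∃ A > (0:ℝ), ‖TT 20 N 0 - (e1 - e2) * A‖ ≤ A / 8 := by
  have hI := integrableOn_lin_sub_exp N 20 1 one_pos
  refine ⟨∫ x in Iic (20:ℝ), exp (N * x - 1 * exp (-4 * x)), ?_, ?_⟩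
  · have : NeZero (volume.restrict (Iic (20:ℝ))) := ⟨by simp [Measure.restrict_eq_zero]⟩
    exact integral_exp_pos hI
  set A := ∫ x in Iic (20:ℝ), exp (N * x - 1 * exp (-4 * x))
  have hlow : exp (-4) ≤ A := by
    have i0 : IntegrableOn (fun _ : ℝ => exp (-4)) (Ioc (0:ℝ) 1) := by simp
    calc exp (-4) = ∫ x in Ioc (0:ℝ) 1, exp (-4) := by simp
      _ ≤ ∫ x in Ioc (0:ℝ) 1, exp (N * x - 1 * exp (-4 * x)) := by
        refine setIntegral_mono_on i0 (hI.mono_set fun x hx => ?_) measurableSet_Ioc fun x hx => ?_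
        · exact hx.2.trans (by norm_num)
        · apply exp_le_exp.2
          have : exp (-4 * x) ≤ 1 := exp_le_one_iff.2 (by linarith [hx.1])
          nlinarith [hx.1, hx.2]
      _ ≤ A := by
        refine setIntegral_mono_set hI (Eventually.of_forall fun x => (exp_pos _).le) ?_
        exact LE.le.eventuallyLE fun x hx => hx.2.trans (by norm_num)
  have hr : ∀ θ e, Complex.exp (-4 * ((θ:ℝ) * Complex.I)) = 1 → Complex.exp (N * ((θ:ℝ) * Complex.I)) = e →
      ∫ x in Iic (20:ℝ), hh N 0 (pt x θ) = e * A := by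
    intro θ e h4 he
    simp only [hh_zero_ray N _ _ h4, he]
    rw [integral_const_mul, integral_complex_ofReal]
  have htt : TT 20 N 0 - (e1 - e2) * A = - (Complex.I * ∫ θ in (π/2)..π, hh N 0 (pt 20 θ)) := by
    unfold TT
    rw [hr π e1 exp_four_pi h1, hr (π/2) e2 exp_four_half_pi h2]; ring
  rw [htt, norm_neg, norm_mul, Complex.norm_I, one_mul]
  have harc : |π - π/2| = π/2 := by rw [abs_of_pos (by linarith [pi_pos])]; ring
  have hb : ‖∫ θ in (π/2)..π, hh N 0 (pt 20 θ)‖ ≤ exp (-19) * |π - π/2| := by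
    refine intervalIntegral.norm_integral_le_of_norm_le_const fun θ _ => ?_
    refine (norm_hh_arc_le N 0 0 20 θ (by simp)).trans (exp_le_exp.2 ?_)
    have hN20 : N * 20 ≤ -20 := by linarith
    rw [zero_mul, add_zero]
    exact (add_le_add hN20 exp_neg_four_le).trans (by norm_num)
  rw [harc] at hb
  have h16 : 16 * exp (-19) ≤ exp (-4) := by
    rw [show (-4:ℝ) = 15 + -19 by norm_num, Real.exp_add]
    refine mul_le_mul_of_nonneg_right ?_ (exp_pos _).le
    linarith [Real.add_one_le_exp (15:ℝ)]
  have hp := pi_le_four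
  nlinarith [exp_pos (-19 : ℝ)]

lemma solve_alpha (J J' : ℂ) (A : ℝ) (hA : 0 < A) (h1 : J.im ≤ -1) (h2 : |J.re| ≤ 1/8)
    (h3 : J'.re ≤ -(7 * A / 8)) (h4 : |J'.im| ≤ 9 * A / 8) :
    ∃ α : ℂ, (α * J').re = 0 ∧ (α * J).re = 1 := by
  have hD : J'.im * J.re - J'.re * J.im ≠ 0 := by
    have a : |J'.im * J.re| ≤ 9 * A / 8 * (1/8) := by
      rw [abs_mul]; exact mul_le_mul h4 h2 (abs_nonneg _) (by positivity)
    have b := (le_abs_self _).trans a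
    have c : 7 * A / 8 ≤ J'.re * J.im := by nlinarith
    intro h; linarith
  refine ⟨⟨J'.im / (J'.im * J.re - J'.re * J.im), J'.re / (J'.im * J.re - J'.re * J.im)⟩, ?_, ?_⟩
  · simp only [Complex.mul_re]; ring
  · simp only [Complex.mul_re]; field_simp

lemma exists_alpha_of (N : ℝ) (hN : N ≤ -1) (hN' : -3 ≤ N) (s : ℝ) (hs : |s| = 1) (e1 e2 : ℂ)
    (h1 : Complex.exp (N * ((π:ℝ) * Complex.I)) = e1)
    (h2 : Complex.exp (N * (((π/2 : ℝ):ℝ) * Complex.I)) = e2) (he : e1 - e2 = -1 + s * Complex.I) :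
    ∃ α : ℂ, (α * TT 20 N 0).re = 0 ∧ (α * TT 20 0 0).re = 1 := by
  obtain ⟨A, hA, hb⟩ := TT_zero_ray N hN hN' e1 e2 h1 h2
  obtain ⟨g1, g2⟩ := TT_zero_zero
  rw [he] at hb
  have a1 := (Complex.abs_re_le_norm _).trans hb
  have a2 := (Complex.abs_im_le_norm _).trans hb
  simp at a1 a2
  refine solve_alpha _ _ A hA g1 g2 ?_ ?_
  · rw [abs_le] at a1; linarith
  · have : |(TT 20 N 0).im| ≤ |(TT 20 N 0).im - s * A| + |s * A| := by
      have := abs_add_le ((TT 20 N 0).im - s * A) (s * A)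
      rwa [sub_add_cancel] at this
    rw [abs_mul, hs, one_mul, abs_of_pos hA] at this
    linarith

lemma exists_alpha_zero : ∃ α : ℂ, (α * TT 20 (-3) 0).re = 0 ∧ (α * TT 20 0 0).re = 1 := by
  refine exists_alpha_of (-3) (by norm_num) (by norm_num) (-1) (by norm_num) (-1) Complex.I ?_ ?_ ?_
  · rw [show (((-3:ℝ):ℂ) * ((π:ℝ) * Complex.I)) = π * Complex.I + (-2 : ℤ) * (2 * π * Complex.I) by
      push_cast; ring, Complex.exp_add, Complex.exp_int_mul_two_pi_mul_I, mul_one, Complex.exp_pi_mul_I]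
  · rw [show (((-3:ℝ):ℂ) * (((π/2:ℝ):ℝ) * Complex.I)) = π / 2 * Complex.I + (-1 : ℤ) * (2 * π * Complex.I) by
      push_cast; ring, Complex.exp_add, Complex.exp_int_mul_two_pi_mul_I, mul_one,
      Complex.exp_pi_div_two_mul_I]
  · push_cast; ring

lemma exists_alpha_one : ∃ α : ℂ, (α * TT 20 (-1) 0).re = 0 ∧ (α * TT 20 0 0).re = 1 := by
  refine exists_alpha_of (-1) (by norm_num) (by norm_num) 1 (by norm_num) (-1) (-Complex.I) ?_ ?_ ?_
  · rw [show (((-1:ℝ):ℂ) * ((π:ℝ) * Complex.I)) = π * Complex.I + (-1 : ℤ) * (2 * π * Complex.I) by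
      push_cast; ring, Complex.exp_add, Complex.exp_int_mul_two_pi_mul_I, mul_one, Complex.exp_pi_mul_I]
  · rw [show (((-1:ℝ):ℂ) * (((π/2:ℝ):ℝ) * Complex.I)) = -(π / 2 * Complex.I) by
      push_cast; ring, Complex.exp_neg, Complex.exp_pi_div_two_mul_I, Complex.inv_I]
  · push_cast; ring

/-! ### The family of real solutions -/

lemma hasDerivAt_sol (α : ℂ) (N Z : ℝ) :
    HasDerivAt (fun Z => (α * TT 20 N Z).re) ((α * TT 20 (N + 1) Z).re) Z :=
  Complex.reCLM.hasFDerivAt.comp_hasDerivAt Z ((hasDerivAt_TT 20 N Z).const_mul α)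

lemma iteratedDeriv_sol (α : ℂ) (N : ℝ) (k : ℕ) :
    iteratedDeriv k (fun Z => (α * TT 20 N Z).re) = fun Z => (α * TT 20 (N + k) Z).re := by
  induction k with
  | zero => simp
  | succ k ih =>
    rw [iteratedDeriv_succ, ih]
    ext Z
    rw [(hasDerivAt_sol α (N + k) Z).deriv]
    push_cast; rw [add_assoc]

lemma contDiff_sol (α : ℂ) (N : ℝ) : ContDiff ℝ (⊤ : ℕ∞) (fun Z => (α * TT 20 N Z).re) := by
  refine contDiff_of_differentiable_iteratedDeriv fun m _ => ?_
  rw [iteratedDeriv_sol]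
  exact fun Z => (hasDerivAt_sol α _ Z).differentiableAt

lemma sol_rec (α : ℂ) (N Z : ℝ) :
    N * (α * TT 20 N Z).re + 4 * (α * TT 20 (N - 4) Z).re + Z * (α * TT 20 (N + 1) Z).re = 0 := by
  have h : (N:ℂ) * (α * TT 20 N Z) + 4 * (α * TT 20 (N - 4) Z) + Z * (α * TT 20 (N + 1) Z) = 0 := by
    linear_combination α * TT_rec 20 N Z
  have := congrArg Complex.re h
  rw [show (4:ℂ) = ((4:ℝ):ℂ) by norm_num] at this
  simpa only [Complex.add_re, Complex.re_ofReal_mul, Complex.zero_re] using this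

lemma hasDerivAt_iter {d : ℝ → ℝ} (hd : ContDiff ℝ (⊤ : ℕ∞) d) (k : ℕ) (x : ℝ) :
    HasDerivAt (iteratedDeriv k d) (iteratedDeriv (k + 1) d x) x := by
  rw [iteratedDeriv_succ]
  refine (hd.differentiable_iteratedDeriv k ?_ x).hasDerivAt
  exact_mod_cast WithTop.coe_lt_top k

lemma uniq_zero (d : ℝ → ℝ) (hd : ContDiff ℝ (⊤ : ℕ∞) d)
    (hode : ∀ Z > (0:ℝ), Z * iteratedDeriv 5 d Z + 4 * d Z = 0)
    (h0 : d 0 = 0) (h1 : iteratedDeriv 1 d 0 = 0) (h4 : iteratedDeriv 4 d 0 = 0)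
    (hint : ∀ k ≤ 4, IntegrableOn (iteratedDeriv k d) (Ioi 0)) : ∀ Z ≥ (0:ℝ), d Z = 0 := by
  obtain ⟨c1, p1, c2, p2, c3, p3, c4, p4, r1, r2⟩ := data_relation (fun k => iteratedDeriv k d)
    (fun k x => hasDerivAt_iter hd k x) (by simpa using hode) (by simpa using h0) hint
  simp only [h1, h4] at r1 r2
  have h3 : iteratedDeriv 3 d 0 = 0 := by
    have : iteratedDeriv 3 d 0 * c3 = 0 := by linarith
    exact (mul_eq_zero.1 this).resolve_right p3.ne'
  have h2 : iteratedDeriv 2 d 0 = 0 := by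
    rw [h3] at r2
    have : iteratedDeriv 2 d 0 * c2 = 0 := by linarith
    exact (mul_eq_zero.1 this).resolve_right p2.ne'
  have := zero_of_data (fun k => iteratedDeriv k d)
    (fun k x => hasDerivAt_iter hd k x) (by simpa using hode) (fun k hk => by
      interval_cases k
      · simpa using h0
      · exact h1
      · exact h2
      · exact h3
      · exact h4)
  simpa using this

lemma uniq_one (d : ℝ → ℝ) (hd : ContDiff ℝ (⊤ : ℕ∞) d)
    (hode : ∀ Z > (0:ℝ), Z * iteratedDeriv 5 d Z - iteratedDeriv 4 d Z + 4 * d Z = 0)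
    (h1 : iteratedDeriv 1 d 0 = 0) (h4 : iteratedDeriv 4 d 0 = 0) (h5 : iteratedDeriv 5 d 0 = 0)
    (hint : ∀ k ≤ 4, IntegrableOn (iteratedDeriv k d) (Ioi 0)) : ∀ Z ≥ (0:ℝ), d Z = 0 := by
  have hder := hasDerivAt_iter hd
  have hcont : ∀ k, Continuous (iteratedDeriv k d) := fun k =>
    continuous_iff_continuousAt.2 fun x => (hder k x).continuousAt
  have hd0 : d = iteratedDeriv 0 d := by simp
  have hode0 : ∀ Z ≥ (0:ℝ), Z * iteratedDeriv 5 d Z - iteratedDeriv 4 d Z + 4 * d Z = 0 := by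
    have hcl : IsClosed {Z : ℝ | Z * iteratedDeriv 5 d Z - iteratedDeriv 4 d Z + 4 * d Z = 0} :=
      isClosed_eq (((continuous_id.mul (hcont 5)).sub (hcont 4)).add
        (continuous_const.mul hd.continuous)) continuous_const
    have := hcl.closure_subset_iff.2 (fun Z (hZ : Z ∈ Ioi (0:ℝ)) => hode Z hZ)
    rw [closure_Ioi] at this
    exact fun Z hZ => this hZ
  have hd00 : d 0 = 0 := by
    have := hode0 0 le_rfl
    rw [h4] at this; linarith
  have hode1 : ∀ Z > (0:ℝ), Z * iteratedDeriv 6 d Z + 4 * iteratedDeriv 1 d Z = 0 := by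
    intro Z hZ
    have e1 : HasDerivAt (fun Z => Z * iteratedDeriv 5 d Z - iteratedDeriv 4 d Z
        + 4 * iteratedDeriv 0 d Z) (1 * iteratedDeriv 5 d Z + Z * iteratedDeriv 6 d Z
          - iteratedDeriv 5 d Z + 4 * iteratedDeriv 1 d Z) Z :=
      (((hasDerivAt_id Z).mul (hder 5 Z)).sub (hder 4 Z)).add ((hder 0 Z).const_mul 4)
    have e2 : (fun Z => Z * iteratedDeriv 5 d Z - iteratedDeriv 4 d Z
        + 4 * iteratedDeriv 0 d Z) =ᶠ[nhds Z] fun _ => 0 := by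
      filter_upwards [Ioi_mem_nhds hZ] with y hy
      rw [← hd0]; exact hode y hy
    have := e1.unique ((hasDerivAt_const Z (0:ℝ)).congr_of_eventuallyEq e2)
    linarith
  have hint5 : IntegrableOn (iteratedDeriv 5 d) (Ioi 0) := by
    rw [← Ioc_union_Ioi_eq_Ioi (zero_le_one' ℝ)]
    refine IntegrableOn.union ?_ ?_
    · exact ((hcont 5).integrableOn_Icc).mono_set Ioc_subset_Icc_self
    · have i4 := (hint 4 le_rfl).mono_set (Ioi_subset_Ioi (zero_le_one' ℝ))
      have i0 := (hint 0 (by norm_num)).mono_set (Ioi_subset_Ioi (zero_le_one' ℝ))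
      refine Integrable.mono' (i4.norm.add (i0.norm.const_mul 4)) (hcont 5).aestronglyMeasurable ?_
      refine (ae_restrict_iff' measurableSet_Ioi).2 (Eventually.of_forall fun x hx => ?_)
      have hx : (1:ℝ) < x := hx
      have hx0 : (0:ℝ) < x := by linarith
      have h2 : x * |iteratedDeriv 5 d x| ≤ |iteratedDeriv 4 d x| + 4 * |iteratedDeriv 0 d x| := by
        have : x * iteratedDeriv 5 d x = iteratedDeriv 4 d x - 4 * iteratedDeriv 0 d x := by
          rw [← hd0]; linarith [hode x hx0]
        calc x * |iteratedDeriv 5 d x| = |x * iteratedDeriv 5 d x| := by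
              rw [abs_mul, abs_of_pos hx0]
          _ ≤ |iteratedDeriv 4 d x| + |4 * iteratedDeriv 0 d x| := by rw [this]; exact abs_sub _ _
          _ = _ := by rw [abs_mul]; norm_num
      simp only [Real.norm_eq_abs, Pi.add_apply]
      nlinarith [abs_nonneg (iteratedDeriv 5 d x)]
  have hintS : ∀ k ≤ 4, IntegrableOn (iteratedDeriv (k + 1) d) (Ioi 0) := by
    intro k hk
    rcases hk.eq_or_lt with rfl | hk
    · exact hint5
    · exact hint (k + 1) hk
  obtain ⟨c1, p1, c2, p2, c3, p3, c4, p4, r1, r2⟩ := data_relation (fun k => iteratedDeriv (k + 1) d)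
    (fun k x => hder (k + 1) x) hode1 h1 hintS
  have h4' : iteratedDeriv (3 + 1) d 0 = 0 := h4
  have h5' : iteratedDeriv (4 + 1) d 0 = 0 := h5
  simp only [h4', h5'] at r1 r2
  have h2 : iteratedDeriv (1 + 1) d 0 = 0 := by
    have : iteratedDeriv (1 + 1) d 0 * c1 = 0 := by linarith
    exact (mul_eq_zero.1 this).resolve_right p1.ne'
  have h3 : iteratedDeriv (2 + 1) d 0 = 0 := by
    rw [h2] at r2
    have : iteratedDeriv (2 + 1) d 0 * c2 = 0 := by linarith
    exact (mul_eq_zero.1 this).resolve_right p2.ne'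
  have hz := zero_of_data (fun k => iteratedDeriv (k + 1) d)
    (fun k x => hder (k + 1) x) hode1 (fun k hk => by
      interval_cases k
      · exact h1
      · exact h2
      · exact h3
      · exact h4
      · exact h5)
  intro Z hZ
  have := Convex.norm_image_sub_le_of_norm_hasDerivWithin_le (f := d) (f' := iteratedDeriv 1 d)
    (s := Icc 0 Z) (C := 0) (fun x _ => by
      have := hder 0 x
      rw [← hd0] at this
      exact this.hasDerivWithinAt) (fun x hx => by
      have := hz x hx.1
      simp only [zero_add] at this
      rw [this]; simp) (convex_Icc _ _) (left_mem_Icc.2 hZ) (right_mem_Icc.2 hZ)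
  rw [hd00] at this
  simpa using this

lemma integrable_of_weighted (χ : ℝ → ℝ) (hχ : ContDiff ℝ (⊤ : ℕ∞) χ) (c : ℝ) (hc : 0 < c) (k : ℕ)
    (h : IntegrableOn (fun Z => |iteratedDeriv k χ Z| * Real.exp (c * Z ^ ((4:ℝ)/5))) (Ioi (0:ℝ))) :
    IntegrableOn (iteratedDeriv k χ) (Ioi 0) := by
  have hcont : Continuous (iteratedDeriv k χ) :=
    continuous_iff_continuousAt.2 fun x => (hasDerivAt_iter hχ k x).continuousAt
  refine Integrable.mono' h hcont.aestronglyMeasurable ?_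
  refine (ae_restrict_iff' measurableSet_Ioi).2 (Eventually.of_forall fun x hx => ?_)
  have hx : 0 < x := hx
  rw [Real.norm_eq_abs]
  refine le_mul_of_one_le_right (abs_nonneg _) (Real.one_le_exp ?_)
  positivity



lemma iteratedDeriv_diff {f g : ℝ → ℝ} (hf : ContDiff ℝ (⊤ : ℕ∞) f) (hg : ContDiff ℝ (⊤ : ℕ∞) g)
    (k : ℕ) : iteratedDeriv k (fun Z => f Z - g Z) =
      fun Z => iteratedDeriv k f Z - iteratedDeriv k g Z := by
  induction k with
  | zero => simp
  | succ k ih =>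
    rw [iteratedDeriv_succ, ih]
    ext Z
    exact ((hasDerivAt_iter hf k Z).sub (hasDerivAt_iter hg k Z)).deriv

/-- **The canonical boundary layer profiles `χ₀, χ₁`** (Corollary C.2). For `j ∈ {0,1}`
there is a unique smooth solution of `Zχ⁽⁵⁾ - jχ⁽⁴⁾ + 4χ = 0` on `(0,∞)` with the
prescribed boundary conditions and weighted integrability
`∫₀^∞ |χ⁽ᵏ⁾| e^{cZ^{4/5}} < ∞` (`0 ≤ k ≤ 4`) for some `c > 0`; moreover
`χ₀⁽⁵⁾(0) = 0` and `χ₁(0) = 0`. -/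
theorem canonical_profiles_chi (j : ℕ) (hj : j ≤ 1) :
    ∃ χ : ℝ → ℝ, ∃ c > (0:ℝ),
      (ContDiff ℝ (⊤ : ℕ∞) χ ∧
        (∀ Z > (0:ℝ),
          Z * iteratedDeriv 5 χ Z - (j:ℝ) * iteratedDeriv 4 χ Z + 4 * χ Z = 0) ∧
        ChiBC j χ ∧
        (∀ k ≤ 4,
          IntegrableOn (fun Z => |iteratedDeriv k χ Z| * Real.exp (c * Z ^ ((4:ℝ)/5)))
            (Ioi (0:ℝ)))) ∧
      -- the additional boundary values
      ((j = 0 → iteratedDeriv 5 χ 0 = 0) ∧ (j = 1 → χ 0 = 0)) ∧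
      -- uniqueness
      (∀ χ' : ℝ → ℝ, ContDiff ℝ (⊤ : ℕ∞) χ' →
        (∀ Z > (0:ℝ),
          Z * iteratedDeriv 5 χ' Z - (j:ℝ) * iteratedDeriv 4 χ' Z + 4 * χ' Z = 0) →
        ChiBC j χ' →
        (∃ c' > (0:ℝ), ∀ k ≤ 4,
          IntegrableOn (fun Z => |iteratedDeriv k χ' Z| * Real.exp (c' * Z ^ ((4:ℝ)/5)))
            (Ioi (0:ℝ))) →
        EqOn χ' χ (Ici 0)) := by
  rcases (by omega : j = 0 ∨ j = 1) with rfl | rfl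
  · obtain ⟨α, ha, hb⟩ := exists_alpha_zero
    set χ : ℝ → ℝ := fun Z => (α * TT 20 (-4) Z).re with hχ
    have hit : ∀ k, iteratedDeriv k χ = fun Z => (α * TT 20 (-4 + k) Z).re :=
      iteratedDeriv_sol α (-4)
    have hcd : ContDiff ℝ (⊤ : ℕ∞) χ := contDiff_sol α (-4)
    have d1 : iteratedDeriv 1 χ 0 = 0 := by
      rw [hit]; norm_num at ha ⊢; exact ha
    have d4 : iteratedDeriv 4 χ 0 = 1 := by
      rw [hit]; norm_num at hb ⊢; exact hb
    have hode : ∀ Z, Z * iteratedDeriv 5 χ Z + 4 * χ Z = 0 := by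
      intro Z
      have h := sol_rec α 0 Z
      rw [hit, hχ]
      norm_num at h ⊢
      linarith
    have d0 : χ 0 = 0 := by
      have := hode 0
      linarith
    have d5 : iteratedDeriv 5 χ 0 = 0 := by
      have h := sol_rec α 1 0
      rw [hit]
      norm_num at h ha ⊢
      linarith
    have hint : ∀ k, IntegrableOn
        (fun Z => |iteratedDeriv k χ Z| * Real.exp (1/64 * Z ^ ((4:ℝ)/5))) (Ioi (0:ℝ)) := by
      intro k
      rw [hit]
      exact weighted_integrable 20 _ α
    refine ⟨χ, 1/64, by norm_num, ⟨hcd, fun Z _ => ?_, ⟨fun _ => ⟨d0, ?_, d4⟩, fun h => by omega⟩,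
      fun k _ => hint k⟩, ⟨fun _ => d5, fun h => by omega⟩, ?_⟩
    · have := hode Z
      push_cast
      linarith
    · rw [← iteratedDeriv_one]; exact d1
    · rintro ψ hψ hψode ⟨hbc, -⟩ ⟨c', hc', hψint⟩ Z hZ
      obtain ⟨b0, b1, b4⟩ := hbc rfl
      rw [← iteratedDeriv_one] at b1
      have hk := iteratedDeriv_diff hψ hcd
      have := uniq_zero (fun Z => ψ Z - χ Z) (hψ.sub hcd) ?_ ?_ ?_ ?_ ?_ Z hZ
      · exact sub_eq_zero.1 this
      · intro Z hZ
        rw [hk]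
        have e1 := hψode Z hZ
        have e2 := hode Z
        push_cast at e1
        linear_combination e1 - e2
      · show ψ 0 - χ 0 = 0
        rw [b0, d0, sub_zero]
      · rw [hk]; show iteratedDeriv 1 ψ 0 - iteratedDeriv 1 χ 0 = 0
        rw [b1, d1, sub_zero]
      · rw [hk]; show iteratedDeriv 4 ψ 0 - iteratedDeriv 4 χ 0 = 0
        rw [b4, d4, sub_self]
      · intro k hk4
        rw [hk]
        exact (integrable_of_weighted ψ hψ c' hc' k (hψint k hk4)).sub
          (integrable_of_weighted χ hcd (1/64) (by norm_num) k (hint k))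
  · obtain ⟨α, ha, hb⟩ := exists_alpha_one
    set χ : ℝ → ℝ := fun Z => (α * TT 20 (-5) Z).re with hχ
    have hit : ∀ k, iteratedDeriv k χ = fun Z => (α * TT 20 (-5 + k) Z).re :=
      iteratedDeriv_sol α (-5)
    have hcd : ContDiff ℝ (⊤ : ℕ∞) χ := contDiff_sol α (-5)
    have d1 : iteratedDeriv 1 χ 0 = 0 := by
      have h := sol_rec α 0 0
      rw [hit]
      norm_num at h ⊢
      linarith
    have d4 : iteratedDeriv 4 χ 0 = 0 := by
      rw [hit]; norm_num at ha ⊢; exact ha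
    have d5 : iteratedDeriv 5 χ 0 = 1 := by
      rw [hit]; norm_num at hb ⊢; exact hb
    have hode : ∀ Z, Z * iteratedDeriv 5 χ Z - iteratedDeriv 4 χ Z + 4 * χ Z = 0 := by
      intro Z
      have h := sol_rec α (-1) Z
      rw [hit, hit, hχ]
      norm_num at h ⊢
      linarith
    have d0 : χ 0 = 0 := by
      have := hode 0
      rw [d4] at this
      linarith
    have hint : ∀ k, IntegrableOn
        (fun Z => |iteratedDeriv k χ Z| * Real.exp (1/64 * Z ^ ((4:ℝ)/5))) (Ioi (0:ℝ)) := by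
      intro k
      rw [hit]
      exact weighted_integrable 20 _ α
    refine ⟨χ, 1/64, by norm_num, ⟨hcd, fun Z _ => ?_, ⟨fun h => by omega, fun _ => ⟨?_, d4, d5⟩⟩,
      fun k _ => hint k⟩, ⟨fun h => by omega, fun _ => d0⟩, ?_⟩
    · have := hode Z
      push_cast
      linarith
    · rw [← iteratedDeriv_one]; exact d1
    · rintro ψ hψ hψode ⟨-, hbc⟩ ⟨c', hc', hψint⟩ Z hZ
      obtain ⟨b1, b4, b5⟩ := hbc rfl
      rw [← iteratedDeriv_one] at b1
      have hk := iteratedDeriv_diff hψ hcd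
      have := uniq_one (fun Z => ψ Z - χ Z) (hψ.sub hcd) ?_ ?_ ?_ ?_ ?_ Z hZ
      · exact sub_eq_zero.1 this
      · intro Z hZ
        rw [hk, hk]
        have e1 := hψode Z hZ
        have e2 := hode Z
        push_cast at e1
        linear_combination e1 - e2
      · rw [hk]; show iteratedDeriv 1 ψ 0 - iteratedDeriv 1 χ 0 = 0
        rw [b1, d1, sub_zero]
      · rw [hk]; show iteratedDeriv 4 ψ 0 - iteratedDeriv 4 χ 0 = 0
        rw [b4, d4, sub_zero]
      · rw [hk]; show iteratedDeriv 5 ψ 0 - iteratedDeriv 5 χ 0 = 0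
        rw [b5, d5, sub_self]
      · intro k hk4
        rw [hk]
        exact (integrable_of_weighted ψ hψ c' hc' k (hψint k hk4)).sub
          (integrable_of_weighted χ hcd (1/64) (by norm_num) k (hint k))
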